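/- Let A, B ⊊ I be nonempty cyclic intervals (connected proper subsets) with ℓ(u_B d_A) = |A| + |B|. Then there exist nonempty cyclic intervals A', B' ⊊ I with |A'| + |B'| = |A| + |B| such that u_B d_A = d_{A'} u_{B'}; moreover (|A'|, |B'|) is one of (|A|, |B|), (|A| + 1, |B| − 1), or (|A| − 1, |B| + 1). -/

import Mathlib

/-- `x : Equiv.Perm ℤ` is an affine permutation in `S̃_{k+1}`: it commutes with
translation by `k+1` and its window sums to `(k+1)(k+2)/2`. -/
def IsAffinePerm (k : ℕ) (x : Equiv.Perm ℤ) : Prop :=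
  (∀ i : ℤ, x (i + (k + 1)) = x i + (k + 1)) ∧
  ∑ i ∈ Finset.Icc (1 : ℤ) (k + 1), x i = (k + 1) * (k + 2) / 2

/-- The underlying function of the simple generator `s_i`. -/
def sAffFun (k : ℕ) (i : ZMod (k + 1)) (j : ℤ) : ℤ :=
  if (j : ZMod (k + 1)) = i then j + 1
  else if (j : ZMod (k + 1)) = i + 1 then j - 1
  else j

theorem sAffFun_invol (k : ℕ) (i : ZMod (k + 1)) (h : ¬ (1 : ZMod (k + 1)) = 0) :
    Function.Involutive (sAffFun k i) := by
  have hne : i + 1 ≠ i := fun hc => h (by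
    have h2 : i + 1 = i + 0 := by simpa using hc
    exact add_left_cancel h2)
  intro j
  by_cases h1 : (j : ZMod (k + 1)) = i
  · have e1 : sAffFun k i j = j + 1 := if_pos h1
    have hj1 : ((j + 1 : ℤ) : ZMod (k + 1)) = i + 1 := by push_cast; rw [h1]
    have e2 : sAffFun k i (j + 1) = j := by
      unfold sAffFun
      rw [if_neg (by rw [hj1]; exact hne), if_pos hj1]
      ring
    rw [e1, e2]
  · by_cases h2 : (j : ZMod (k + 1)) = i + 1
    · have e1 : sAffFun k i j = j - 1 := by unfold sAffFun; rw [if_neg h1, if_pos h2]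
      have hj1 : ((j - 1 : ℤ) : ZMod (k + 1)) = i := by push_cast; rw [h2]; ring
      have e2 : sAffFun k i (j - 1) = j := by
        unfold sAffFun; rw [if_pos hj1]; ring
      rw [e1, e2]
    · have e1 : sAffFun k i j = j := by unfold sAffFun; rw [if_neg h1, if_neg h2]
      rw [e1, e1]

/-- The simple generator `s_i` of the affine symmetric group, as a permutation of `ℤ`:
it interchanges `m(k+1) + ī` and `m(k+1) + ī + 1` for every `m` (when `k ≥ 1`). -/
noncomputable def sAff (k : ℕ) (i : ZMod (k + 1)) : Equiv.Perm ℤ :=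
  if h : (1 : ZMod (k + 1)) = 0 then 1 else Function.Involutive.toPerm _ (sAffFun_invol k i h)

/-- The Coxeter length of `x`: the least number of simple generators whose product is `x`. -/
noncomputable def affLen (k : ℕ) (x : Equiv.Perm ℤ) : ℕ :=
  sInf {n : ℕ | ∃ w : List (ZMod (k + 1)), w.length = n ∧ x = (w.map (sAff k)).prod}

/-- The right descent set `D_R(x) = {i : ℓ(x s_i) < ℓ(x)}`. -/
noncomputable def rightDescents (k : ℕ) (x : Equiv.Perm ℤ) : Set (ZMod (k + 1)) :=
  {i | affLen k (x * sAff k i) < affLen k x}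

/-- The cyclic interval `[i,j] = {i, i+1, …, j}` of residues mod `k+1`. -/
def cycInt (k : ℕ) (i j : ZMod (k + 1)) : Finset (ZMod (k + 1)) :=
  (Finset.range ((j - i).val + 1)).image fun t : ℕ => i + (t : ZMod (k + 1))

/-- A choice of a "gate" residue not belonging to `A` (when `A` is proper). -/
noncomputable def gate (k : ℕ) (A : Finset (ZMod (k + 1))) : ZMod (k + 1) :=
  if h : ∃ g, g ∉ A then h.choose else 0

/-- The cyclically decreasing element `d_A`: the product of the `s_a`, `a ∈ A`, in an
order where `s_{a+1}` occurs to the left of `s_a` whenever `a, a+1 ∈ A`. -/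
noncomputable def dElt (k : ℕ) (A : Finset (ZMod (k + 1))) : Equiv.Perm ℤ :=
  (((((List.range (k + 1)).reverse.map fun t : ℕ => gate k A + (t : ZMod (k + 1))).filter
      fun a => decide (a ∈ A)).map (sAff k)).prod)

/-- The cyclically increasing element `u_A`: the product of the `s_a`, `a ∈ A`, in an
order where `s_{a+1}` occurs to the right of `s_a` whenever `a, a+1 ∈ A`. -/
noncomputable def uElt (k : ℕ) (A : Finset (ZMod (k + 1))) : Equiv.Perm ℤ :=
  ((((List.range (k + 1)).map fun t : ℕ => gate k A + (t : ZMod (k + 1))).filter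
      fun a => decide (a ∈ A)).map (sAff k)).prod

/-- The right decreasing code: `CRD(x)_i = #{j < ī : x(j) > x(ī)}`. -/
noncomputable def CRD (k : ℕ) (x : Equiv.Perm ℤ) (i : ZMod (k + 1)) : ℕ :=
  Set.ncard {j : ℤ | j < (i.val : ℤ) ∧ x (i.val : ℤ) < x j}

/-- The right increasing code: `CRI(x)_i = #{j > ī + 1 : x(j) < x(ī + 1)}`. -/
noncomputable def CRI (k : ℕ) (x : Equiv.Perm ℤ) (i : ZMod (k + 1)) : ℕ :=
  Set.ncard {j : ℤ | (i.val : ℤ) + 1 < j ∧ x j < x ((i.val : ℤ) + 1)}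

/-- The left decreasing code: `CLD(x)_i = #{j < x⁻¹(ī + 1) : x(j) > ī + 1}`. -/
noncomputable def CLD (k : ℕ) (x : Equiv.Perm ℤ) (i : ZMod (k + 1)) : ℕ :=
  Set.ncard {j : ℤ | j < x.symm ((i.val : ℤ) + 1) ∧ (i.val : ℤ) + 1 < x j}

/-- The left increasing code: `CLI(x)_i = #{j > x⁻¹(ī) : x(j) < ī}`. -/
noncomputable def CLI (k : ℕ) (x : Equiv.Perm ℤ) (i : ZMod (k + 1)) : ℕ :=
  Set.ncard {j : ℤ | x.symm ((i.val : ℤ)) < j ∧ x j < (i.val : ℤ)}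

theorem zmod_natCast_ne {k t u : ℕ} (h : t < u) (h' : u < t + (k + 1)) :
    (t : ZMod (k + 1)) ≠ u := by
  intro he
  have hd : ((u - t : ℕ) : ZMod (k + 1)) = 0 := by
    rw [Nat.cast_sub h.le, he, sub_self]
  rw [ZMod.natCast_eq_zero_iff] at hd
  have := Nat.le_of_dvd (by omega) hd
  omega

theorem zmod_natCast_ne' {k t u : ℕ} (h : u < t) (h' : t < u + (k + 1)) :
    (t : ZMod (k + 1)) ≠ u :=
  (zmod_natCast_ne h h').symm

theorem zmod_natCast_add_one (k : ℕ) : (k : ZMod (k + 1)) + 1 = 0 := by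
  exact_mod_cast ZMod.natCast_self (k + 1)

/-! ### Coxeter relations -/

section Coxeter

variable {k : ℕ}

theorem zmod_one_ne_zero (hk : 1 ≤ k) : ¬ (1 : ZMod (k + 1)) = 0 := by
  have := zmod_natCast_ne' (k := k) (t := 1) (u := 0) (by omega) (by omega)
  simpa using this

theorem sAff_apply (hk : 1 ≤ k) (i : ZMod (k + 1)) (x : ℤ) :
    sAff k i x = sAffFun k i x := by
  unfold sAff
  rw [dif_neg (zmod_one_ne_zero hk)]
  rfl

theorem sAff_apply_self (hk : 1 ≤ k) {i : ZMod (k + 1)} {x : ℤ} (h : (x : ZMod (k + 1)) = i) :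
    sAff k i x = x + 1 := by
  rw [sAff_apply hk, sAffFun, if_pos h]

theorem sAff_apply_succ (hk : 1 ≤ k) {i : ZMod (k + 1)} {x : ℤ}
    (h : (x : ZMod (k + 1)) = i + 1) : sAff k i x = x - 1 := by
  have h1 := zmod_one_ne_zero hk
  rw [sAff_apply hk, sAffFun, if_neg (by rw [h]; simpa using h1), if_pos h]

theorem sAff_apply_of_ne (hk : 1 ≤ k) {i : ZMod (k + 1)} {x : ℤ}
    (h : (x : ZMod (k + 1)) ≠ i) (h' : (x : ZMod (k + 1)) ≠ i + 1) : sAff k i x = x := by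
  rw [sAff_apply hk, sAffFun, if_neg h, if_neg h']

theorem sAff_mul_self (hk : 1 ≤ k) (i : ZMod (k + 1)) : sAff k i * sAff k i = 1 := by
  ext x
  rw [Equiv.Perm.mul_apply, sAff_apply hk, sAff_apply hk,
    sAffFun_invol k i (zmod_one_ne_zero hk) x, Equiv.Perm.one_apply]

theorem sAff_inv (hk : 1 ≤ k) (i : ZMod (k + 1)) : (sAff k i)⁻¹ = sAff k i :=
  inv_eq_of_mul_eq_one_left (sAff_mul_self hk i)

theorem sAff_commute (hk : 1 ≤ k) {i j : ZMod (k + 1)} (h : j ≠ i + 1) (h' : i ≠ j + 1) :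
    Commute (sAff k i) (sAff k j) := by
  rcases eq_or_ne i j with rfl | hij
  · exact Commute.refl _
  have hij1 : i + 1 ≠ j + 1 := fun e => hij (add_right_cancel e)
  refine Equiv.ext fun x => ?_
  rw [Equiv.Perm.mul_apply, Equiv.Perm.mul_apply]
  by_cases h1 : (x : ZMod (k + 1)) = i
  · rw [sAff_apply_self hk h1, sAff_apply_of_ne (i := j) hk (by rwa [h1]) (by rwa [h1]),
      sAff_apply_self hk h1, sAff_apply_of_ne hk] <;> push_cast <;> rw [h1]
    · exact h.symm
    · exact hij1
  by_cases h2 : (x : ZMod (k + 1)) = i + 1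
  · rw [sAff_apply_succ hk h2, sAff_apply_of_ne (i := j) hk (by rw [h2]; exact h.symm)
      (by rwa [h2]), sAff_apply_succ hk h2, sAff_apply_of_ne hk] <;> push_cast <;>
      rw [h2, add_sub_cancel_right]
    · exact hij
    · exact h'
  rw [sAff_apply_of_ne hk h1 h2]
  by_cases h3 : (x : ZMod (k + 1)) = j
  · rw [sAff_apply_self hk h3, sAff_apply_of_ne hk] <;> push_cast <;> rw [h3]
    · exact h'.symm
    · exact hij1.symm
  by_cases h4 : (x : ZMod (k + 1)) = j + 1
  · rw [sAff_apply_succ hk h4, sAff_apply_of_ne hk] <;> push_cast <;>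
      rw [h4, add_sub_cancel_right]
    · exact hij.symm
    · exact h
  rw [sAff_apply_of_ne hk h3 h4, sAff_apply_of_ne hk h1 h2]

theorem sAff_braid (hk : 2 ≤ k) (i : ZMod (k + 1)) :
    sAff k i * sAff k (i + 1) * sAff k i = sAff k (i + 1) * sAff k i * sAff k (i + 1) := by
  have hk1 : 1 ≤ k := by omega
  have n1 : (1 : ZMod (k + 1)) ≠ 0 := zmod_one_ne_zero hk1
  have n2 : (1 + 1 : ZMod (k + 1)) ≠ 0 := by
    have := zmod_natCast_ne' (k := k) (t := 2) (u := 0) (by omega) (by omega)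
    push_cast at this
    rwa [one_add_one_eq_two]
  refine Equiv.ext fun x => ?_
  simp only [Equiv.Perm.mul_apply]
  by_cases h0 : (x : ZMod (k + 1)) = i
  · rw [sAff_apply_self hk1 h0,
      sAff_apply_self (i := i + 1) (x := x + 1) hk1 (by push_cast; rw [h0]),
      sAff_apply_of_ne hk1, sAff_apply_of_ne (i := i + 1) (x := x) hk1,
      sAff_apply_self hk1 h0, sAff_apply_self hk1] <;> push_cast <;> rw [h0] <;>
      simp [add_assoc, n1, n2]
  by_cases h1 : (x : ZMod (k + 1)) = i + 1
  · rw [sAff_apply_succ hk1 h1, sAff_apply_of_ne (i := i + 1) (x := x - 1) hk1,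
      sAff_apply_self (x := x - 1) hk1, sAff_apply_self (x := x) hk1 h1,
      sAff_apply_of_ne (x := x + 1) hk1, sAff_apply_succ (x := x + 1) hk1] <;>
      push_cast <;> (try rw [h1]) <;> simp [add_assoc, n1, n2]
  by_cases h2 : (x : ZMod (k + 1)) = i + 1 + 1
  · rw [sAff_apply_of_ne hk1 h0 h1, sAff_apply_succ hk1 h2, sAff_apply_succ (x := x - 1) hk1,
      sAff_apply_of_ne (x := x - 1 - 1) hk1] <;>
      push_cast <;> rw [h2] <;> simp [n1]
    simpa [add_assoc] using n2
  rw [sAff_apply_of_ne hk1 h0 h1, sAff_apply_of_ne hk1 h1 h2, sAff_apply_of_ne hk1 h0 h1,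
    sAff_apply_of_ne hk1 h1 h2]

end Coxeter

/-! ### Runs of consecutive generators -/

/-- The increasing run `a, a+1, …, a+p-1` of residues. -/
def residueRun (k : ℕ) (a : ZMod (k + 1)) (p : ℕ) : List (ZMod (k + 1)) :=
  (List.range p).map fun t : ℕ => a + (t : ZMod (k + 1))

/-- The product `s_{a+p-1} ⋯ s_{a+1} s_a`. -/
noncomputable def downRun (k : ℕ) (a : ZMod (k + 1)) (p : ℕ) : Equiv.Perm ℤ :=
  ((residueRun k a p).reverse.map (sAff k)).prod

/-- The product `s_a s_{a+1} ⋯ s_{a+p-1}`. -/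
noncomputable def upRun (k : ℕ) (a : ZMod (k + 1)) (p : ℕ) : Equiv.Perm ℤ :=
  ((residueRun k a p).map (sAff k)).prod

section Runs

variable {k : ℕ}

@[simp] theorem residueRun_length (a : ZMod (k + 1)) (p : ℕ) :
    (residueRun k a p).length = p := by
  simp [residueRun]

theorem mem_residueRun {a x : ZMod (k + 1)} {p : ℕ} :
    x ∈ residueRun k a p ↔ ∃ t < p, a + (t : ZMod (k + 1)) = x := by
  simp [residueRun]

theorem residueRun_add (a : ZMod (k + 1)) (p q : ℕ) :
    residueRun k a (p + q) = residueRun k a p ++ residueRun k (a + p) q := by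
  simp [residueRun, List.range_add, add_assoc, Function.comp_def]

theorem downRun_add (a : ZMod (k + 1)) (p q : ℕ) :
    downRun k a (p + q) = downRun k (a + p) q * downRun k a p := by
  simp [downRun, residueRun_add]

theorem upRun_add (a : ZMod (k + 1)) (p q : ℕ) :
    upRun k a (p + q) = upRun k a p * upRun k (a + p) q := by
  simp [upRun, residueRun_add]

@[simp] theorem downRun_one (a : ZMod (k + 1)) : downRun k a 1 = sAff k a := by
  simp [downRun, residueRun]

@[simp] theorem upRun_one (a : ZMod (k + 1)) : upRun k a 1 = sAff k a := by
  simp [upRun, residueRun]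

@[simp] theorem downRun_zero (a : ZMod (k + 1)) : downRun k a 0 = 1 := by
  simp [downRun, residueRun]

@[simp] theorem upRun_zero (a : ZMod (k + 1)) : upRun k a 0 = 1 := by
  simp [upRun, residueRun]

theorem downRun_succ (a : ZMod (k + 1)) (p : ℕ) :
    downRun k a (p + 1) = sAff k (a + p) * downRun k a p := by
  rw [downRun_add, downRun_one]

theorem upRun_succ (a : ZMod (k + 1)) (p : ℕ) :
    upRun k a (p + 1) = upRun k a p * sAff k (a + p) := by
  rw [upRun_add, upRun_one]

theorem downRun_succ' (a : ZMod (k + 1)) (p : ℕ) :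
    downRun k a (p + 1) = downRun k (a + 1) p * sAff k a := by
  rw [add_comm p, downRun_add, downRun_one, Nat.cast_one]

theorem upRun_succ' (a : ZMod (k + 1)) (p : ℕ) :
    upRun k a (p + 1) = sAff k a * upRun k (a + 1) p := by
  rw [add_comm p, upRun_add, upRun_one, Nat.cast_one]

theorem upRun_eq_inv (hk : 1 ≤ k) (a : ZMod (k + 1)) (p : ℕ) :
    upRun k a p = (downRun k a p)⁻¹ := by
  induction p with
  | zero => simp
  | succ p ih => rw [upRun_succ, downRun_succ, mul_inv_rev, sAff_inv hk, ih]

theorem sAff_commute_downRun (hk : 1 ≤ k) {j c : ZMod (k + 1)} {w : ℕ}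
    (h : ∀ u < w, c + u ≠ j + 1 ∧ j ≠ c + u + 1) : Commute (sAff k j) (downRun k c w) := by
  induction w with
  | zero => simp
  | succ w ih =>
    rw [downRun_succ]
    exact (sAff_commute hk (h w (by omega)).1 (h w (by omega)).2).mul_right
      (ih fun u hu => h u (by omega))

/-- A generator whose residue lies in the run, but not at its top, moves through the run. -/
theorem sAff_mul_downRun {t p : ℕ} (a : ZMod (k + 1)) (ht : t + 2 ≤ p) (hp : p ≤ k) :
    sAff k (a + t) * downRun k a p = downRun k a p * sAff k (a + t + 1) := by
  obtain ⟨w, rfl⟩ := Nat.exists_eq_add_of_le ht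
  have e : downRun k a (t + 2 + w) = downRun k (a + t + 2) w *
      (sAff k (a + t + 1) * sAff k (a + t)) * downRun k a t := by
    rw [downRun_add, downRun_succ, downRun_succ]
    push_cast
    simp only [mul_assoc, add_assoc]
  have c1 : Commute (sAff k (a + t)) (downRun k (a + t + 2) w) := by
    refine sAff_commute_downRun (by omega) fun u hu => ⟨fun h => ?_, fun h => ?_⟩
    · refine zmod_natCast_ne' (k := k) (t := u + 1) (u := 0) (by omega) (by omega) ?_
      push_cast
      linear_combination h
    · refine zmod_natCast_ne' (k := k) (t := u + 3) (u := 0) (by omega) (by omega) ?_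
      push_cast
      linear_combination -h
  have c2 : Commute (sAff k (a + t + 1)) (downRun k a t) := by
    refine sAff_commute_downRun (by omega) fun u hu => ⟨fun h => ?_, fun h => ?_⟩
    · refine zmod_natCast_ne' (k := k) (t := t + 2) (u := u) (by omega) (by omega) ?_
      push_cast
      linear_combination -h
    · refine zmod_natCast_ne' (k := k) (t := t) (u := u) (by omega) (by omega) ?_
      linear_combination h
  have br := sAff_braid (k := k) (by omega) (a + t)
  rw [e]
  simp only [mul_assoc] at br ⊢
  rw [← c2.eq, ← mul_assoc, c1.eq, mul_assoc]
  congr 1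
  simp only [← mul_assoc] at br ⊢
  rw [br]

theorem upRun_mul_downRun_of_subset {t p r : ℕ} (a : ZMod (k + 1)) (ht : t + r + 1 ≤ p)
    (hp : p ≤ k) :
    upRun k (a + t) r * downRun k a p = downRun k a p * upRun k (a + t + 1) r := by
  induction r with
  | zero => simp
  | succ r ih =>
    have h := sAff_mul_downRun (t := t + r) (p := p) a (by omega) hp
    rw [Nat.cast_add, ← add_assoc] at h
    rw [upRun_succ, mul_assoc, h, ← mul_assoc, ih (by omega), mul_assoc, upRun_succ,
      add_right_comm _ (1 : ZMod (k + 1))]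

theorem upRun_commute_downRun {e p q : ℕ} (hk : 1 ≤ k) (a : ZMod (k + 1)) (he : p < e)
    (hq : e + q ≤ k) : Commute (upRun k (a + e) q) (downRun k a p) := by
  induction q with
  | zero => simp
  | succ q ih =>
    rw [upRun_succ]
    refine (ih (by omega)).mul_left (sAff_commute_downRun hk fun u hu => ⟨fun h => ?_, fun h => ?_⟩)
    · refine zmod_natCast_ne' (k := k) (t := e + q + 1) (u := u) (by omega) (by omega) ?_
      push_cast
      linear_combination -h
    · refine zmod_natCast_ne' (k := k) (t := e + q) (u := u + 1) (by omega) (by omega) ?_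
      push_cast
      linear_combination h

/-- The up run ends just below the down run. -/
theorem upRun_mul_downRun_of_adjacent_below {p q : ℕ} (hk : 1 ≤ k) (b : ZMod (k + 1))
    (h : p + q + 1 ≤ k) :
    upRun k b q * downRun k (b + q) (p + 1) =
      downRun k (b + q + 1) p * upRun k b (q + 1) := by
  have c := upRun_commute_downRun (e := k - q) (p := p) (q := q) hk (b + q + 1)
    (by omega) (by omega)
  have hb : b + q + 1 + ((k - q : ℕ) : ZMod (k + 1)) = b := by
    rw [Nat.cast_sub (by omega)]
    linear_combination zmod_natCast_add_one k
  rw [hb] at c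
  rw [downRun_succ', ← mul_assoc, c.eq, mul_assoc, ← upRun_succ]

/-- The up run starts just above the down run. -/
theorem upRun_mul_downRun_of_adjacent_above {p q : ℕ} (hk : 1 ≤ k) (a : ZMod (k + 1))
    (h : p + q + 1 ≤ k) :
    upRun k (a + p) (q + 1) * downRun k a p =
      downRun k a (p + 1) * upRun k (a + p + 1) q := by
  have c := upRun_commute_downRun (e := p + 1) (p := p) (q := q) hk a (by omega) (by omega)
  rw [Nat.cast_add, Nat.cast_one, ← add_assoc] at c
  rw [upRun_succ', mul_assoc, c.eq, ← mul_assoc, ← downRun_succ]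

/-- The up run and the down run are complementary. -/
theorem upRun_mul_downRun_of_complement {p q : ℕ} (hk : 1 ≤ k) (a : ZMod (k + 1)) (hp : 1 ≤ p)
    (hq : 1 ≤ q) (h : p + q = k + 1) :
    upRun k (a + p) q * downRun k a p = downRun k (a + 1) p * upRun k (a + p + 1) q := by
  obtain ⟨p, rfl⟩ := Nat.exists_eq_add_of_le' hp
  obtain ⟨q, rfl⟩ := Nat.exists_eq_add_of_le' hq
  have c := upRun_commute_downRun (e := p + 1) (p := p) (q := q) hk (a + 1)
    (by omega) (by omega)
  have e1 : a + 1 + ((p + 1 : ℕ) : ZMod (k + 1)) = a + ((p + 1 : ℕ) : ZMod (k + 1)) + 1 := by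
    ring
  have e2 : a + ((p + 1 : ℕ) : ZMod (k + 1)) + 1 + q = a := by
    have hz : ((p + 1 + (q + 1) : ℕ) : ZMod (k + 1)) = 0 := by rw [h, ZMod.natCast_self]
    push_cast at hz ⊢
    linear_combination hz
  have e3 : a + 1 + (p : ZMod (k + 1)) = a + ((p + 1 : ℕ) : ZMod (k + 1)) := by
    push_cast; ring
  rw [e1] at c
  rw [upRun_succ', downRun_succ', downRun_succ (a + 1), upRun_succ, e2, e3]
  simp only [mul_assoc]
  rw [← mul_assoc (upRun _ _ _), c.eq, mul_assoc]

/-- `x` is a product of a down run and an up run, of lengths as in the exchange of a product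
of an up run of length `q` with a down run of length `p`. -/
def HasDownUp (k p q : ℕ) (x : Equiv.Perm ℤ) : Prop :=
  ∃ (a b : ZMod (k + 1)) (p' q' : ℕ), 1 ≤ p' ∧ p' ≤ k ∧ 1 ≤ q' ∧ q' ≤ k ∧
    x = downRun k a p' * upRun k b q' ∧
    ((p' = p ∧ q' = q) ∨ (p' = p + 1 ∧ q' + 1 = q) ∨ (p' + 1 = p ∧ q' = q + 1))

theorem HasDownUp.inv {p q : ℕ} {x : Equiv.Perm ℤ} (hk : 1 ≤ k) (h : HasDownUp k p q x) :
    HasDownUp k q p x⁻¹ := by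
  obtain ⟨a, b, p', q', hp, hp', hq, hq', rfl, hs⟩ := h
  refine ⟨b, a, q', p', hq, hq', hp, hp', ?_, by omega⟩
  rw [mul_inv_rev, upRun_eq_inv hk, upRun_eq_inv hk, inv_inv]

/-- The top of the up run lies in the down run, strictly below the top of the latter. -/
theorem hasDownUp_of_top_mem {a b : ZMod (k + 1)} {p q c : ℕ} (hq : 1 ≤ q) (hp' : p ≤ k)
    (hq' : q ≤ k) (hc : c + 2 ≤ p) (h : b + q = a + c + 1) :
    HasDownUp k p q (upRun k b q * downRun k a p) := by
  have hk : 1 ≤ k := by omega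
  rcases le_or_gt q (c + 1) with hqc | hqc
  · obtain ⟨t, ht⟩ := Nat.exists_eq_add_of_le' hqc
    obtain rfl : b = a + t := by
      have ht' : (c : ZMod (k + 1)) + 1 = t + q := by
        exact_mod_cast congrArg (Nat.cast : ℕ → ZMod (k + 1)) ht
      linear_combination h + ht'
    exact ⟨a, _, p, q, by omega, hp', hq, hq',
      upRun_mul_downRun_of_subset a (by omega) hp', by omega⟩
  obtain ⟨m, rfl⟩ := Nat.exists_eq_add_of_le' hqc.le
  obtain rfl : a = b + m := by
    push_cast at h
    linear_combination -h
  have s1 := upRun_mul_downRun_of_subset (t := 0) (p := p) (r := c + 1) (b + (m : ZMod (k + 1))) (by omega) hp'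
  rw [Nat.cast_zero, add_zero] at s1
  rw [upRun_add, mul_assoc, s1, ← mul_assoc]
  rcases lt_trichotomy (m + p) (k + 1) with hm | hm | hm
  · obtain ⟨p, rfl⟩ := Nat.exists_eq_add_of_le' (show 1 ≤ p by omega)
    refine ⟨b + m + 1, b, p, m + 1 + (c + 1), by omega, by omega, by omega, by omega, ?_, by omega⟩
    rw [upRun_mul_downRun_of_adjacent_below hk b (by omega), upRun_add b (m + 1), Nat.cast_add,
      Nat.cast_one, ← add_assoc b, mul_assoc]
  · refine ⟨b + m + 1, b + 1, p, m + (c + 1), by omega, by omega, by omega, by omega, ?_,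
      by omega⟩
    have s2 := upRun_mul_downRun_of_complement (p := p) (q := m) hk (b + m) (by omega)
      (by omega) (by omega)
    have hb : b + m + p = b := by
      have : ((m + p : ℕ) : ZMod (k + 1)) = 0 := by rw [hm, ZMod.natCast_self]
      push_cast at this
      linear_combination this
    rw [hb] at s2
    rw [s2, upRun_add (b + 1), mul_assoc, add_right_comm b 1]
  · obtain ⟨d, hd⟩ := Nat.exists_eq_add_of_le (show p ≤ k + 1 by omega)
    obtain ⟨r, rfl⟩ := Nat.exists_eq_add_of_le' (show d ≤ m by omega)
    have hz : (p : ZMod (k + 1)) + d = 0 := by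
      have : ((p + d : ℕ) : ZMod (k + 1)) = 0 := by
        rw [show p + d = k + 1 by omega, ZMod.natCast_self]
      exact_mod_cast this
    have s2 := upRun_mul_downRun_of_complement (p := p) (q := d) hk
      (b + ((r + d : ℕ) : ZMod (k + 1)))
      (by omega) (by omega) (by omega)
    have s3 := upRun_mul_downRun_of_subset (t := p - r - 1) (p := p) (r := r)
      (b + ((r + d : ℕ) : ZMod (k + 1)) + 1) (by omega) hp'
    have e1 : b + (r + d : ℕ) + p = b + r := by
      push_cast
      linear_combination hz
    have e2 : b + (r + d : ℕ) + 1 + (p - r - 1 : ℕ) = b := by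
      rw [Nat.cast_sub (by omega), Nat.cast_sub (by omega)]
      push_cast
      linear_combination hz
    rw [e1] at s2
    rw [e2] at s3
    refine ⟨b + (r + d : ℕ) + 1, b + 1, p, r + d + (c + 1), by omega, by omega, by omega,
      by omega, ?_, by omega⟩
    rw [upRun_add, mul_assoc (upRun k b r), s2, ← mul_assoc, s3, upRun_add (b + 1) (r + d),
      upRun_add (b + 1) r, add_right_comm b 1, add_right_comm b 1]
    simp only [mul_assoc]

theorem hasDownUp_of_disjoint {a b : ZMod (k + 1)} {p q e : ℕ} (hp : 1 ≤ p) (hq : 1 ≤ q)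
    (he : p ≤ e) (heq : e + q ≤ k + 1) (h : b = a + e) :
    HasDownUp k p q (upRun k b q * downRun k a p) := by
  have hk : 1 ≤ k := by omega
  subst h
  rcases he.eq_or_lt with rfl | he <;> rcases heq.eq_or_lt with heq | heq
  · exact ⟨_, _, p, q, hp, by omega, hq, by omega,
      upRun_mul_downRun_of_complement hk a hp hq heq, by omega⟩
  · obtain ⟨q, rfl⟩ := Nat.exists_eq_add_of_le' hq
    have s := upRun_mul_downRun_of_adjacent_above (p := p) (q := q) hk a (by omega)
    rcases Nat.eq_zero_or_pos q with rfl | hq0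
    · refine ⟨a + 1, a, p, 1, hp, by omega, le_rfl, hk, ?_, by omega⟩
      rw [s, upRun_zero, mul_one, downRun_succ', upRun_one]
    · exact ⟨_, _, p + 1, q, by omega, by omega, hq0, by omega, s, by omega⟩
  · obtain ⟨p, rfl⟩ := Nat.exists_eq_add_of_le' hp
    have s := upRun_mul_downRun_of_adjacent_below (p := p) (q := q) hk (a + e) (by omega)
    have ha : a + e + q = a := by
      have : ((e + q : ℕ) : ZMod (k + 1)) = 0 := by rw [heq, ZMod.natCast_self]
      push_cast at this
      linear_combination this
    rw [ha] at s
    rcases Nat.eq_zero_or_pos p with rfl | hp0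
    · refine ⟨a + e, a + e + 1, 1, q, le_rfl, hk, hq, by omega, ?_, by omega⟩
      rw [s, downRun_zero, one_mul, upRun_succ', downRun_one]
    · exact ⟨_, _, p, q + 1, hp0, by omega, by omega, by omega, s, by omega⟩
  · exact ⟨_, _, p, q, hp, by omega, hq, by omega,
      (upRun_commute_downRun hk a he (by omega)).eq, by omega⟩

theorem hasDownUp_of_top_ne {a b : ZMod (k + 1)} {p q : ℕ} (hp : 1 ≤ p) (hq : 1 ≤ q)
    (hp' : p ≤ k) (hq' : q ≤ k) (h : a + p ≠ b + q) :
    HasDownUp k p q (upRun k b q * downRun k a p) := by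
  have hk : 1 ≤ k := by omega
  obtain ⟨c, hck, hc⟩ : ∃ c : ℕ, c < k + 1 ∧ b + q = a + c + 1 :=
    ⟨(b + q - 1 - a).val, ZMod.val_lt _, by rw [ZMod.natCast_zmod_val]; ring⟩
  have hcp : c + 1 ≠ p := by
    rintro rfl
    apply h
    push_cast
    rw [hc, add_assoc]
  rcases Nat.lt_or_gt_of_ne hcp with hcp | hcp
  · exact hasDownUp_of_top_mem hq hp' hq' hcp hc
  rcases le_or_gt (p + q) (c + 1) with hpq | hpq
  · refine hasDownUp_of_disjoint (e := c + 1 - q) hp hq (by omega) (by omega) ?_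
    rw [Nat.cast_sub (by omega)]
    push_cast
    linear_combination hc
  · have s := hasDownUp_of_top_mem (a := b) (b := a) (p := q) (q := p) (c := p + q - c - 2)
      hp hq' hp' (by omega) (by
        rw [Nat.cast_sub (by omega), Nat.cast_sub (by omega)]
        push_cast
        linear_combination -hc)
    have s' := s.inv hk
    rwa [mul_inv_rev, upRun_eq_inv hk, inv_inv, ← upRun_eq_inv hk] at s'

theorem affLen_upRun_mul_downRun_lt {a b : ZMod (k + 1)} {p q : ℕ} (hk : 1 ≤ k) (hp : 1 ≤ p)
    (hq : 1 ≤ q) (h : a + p = b + q) :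
    affLen k (upRun k b q * downRun k a p) < p + q := by
  obtain ⟨p, rfl⟩ := Nat.exists_eq_add_of_le' hp
  obtain ⟨q, rfl⟩ := Nat.exists_eq_add_of_le' hq
  have h' : a + p = b + q := by
    push_cast at h
    linear_combination h
  have e : upRun k b (q + 1) * downRun k a (p + 1) = upRun k b q * downRun k a p := by
    rw [upRun_succ, downRun_succ, h', mul_assoc, ← mul_assoc (sAff k _), sAff_mul_self hk,
      one_mul]
  have hle : affLen k (upRun k b q * downRun k a p) ≤ q + p :=
    Nat.sInf_le ⟨residueRun k b q ++ (residueRun k a p).reverse, by simp,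
      by simp [upRun, downRun]⟩
  rw [e]
  omega

end Runs

/-! ### Cyclic intervals -/

section Intervals

variable {k : ℕ}

theorem cycInt_eq_toFinset (a j : ZMod (k + 1)) :
    cycInt k a j = (residueRun k a ((j - a).val + 1)).toFinset := by
  ext x
  simp [cycInt, mem_residueRun]

theorem toFinset_residueRun_eq_cycInt (a : ZMod (k + 1)) {p : ℕ} (hp : 1 ≤ p) (hp' : p ≤ k + 1) :
    (residueRun k a p).toFinset = cycInt k a (a + (p - 1 : ℕ)) := by
  rw [cycInt_eq_toFinset, add_sub_cancel_left, ZMod.val_natCast_of_lt (by omega),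
    Nat.sub_add_cancel hp]

theorem card_toFinset_residueRun (a : ZMod (k + 1)) {p : ℕ} (hp : p ≤ k + 1) :
    (residueRun k a p).toFinset.card = p := by
  rw [List.toFinset_card_of_nodup, residueRun_length]
  refine List.Nodup.map_on (fun t ht u hu htu => ?_) List.nodup_range
  rw [List.mem_range] at ht hu
  have htu' := add_left_cancel htu
  by_contra hne
  rcases Nat.lt_or_gt_of_ne hne with hlt | hlt
  · exact zmod_natCast_ne hlt (by omega) htu'
  · exact zmod_natCast_ne' hlt (by omega) htu'

theorem toFinset_residueRun_ne_univ (a : ZMod (k + 1)) {p : ℕ} (hp : p ≤ k) :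
    (residueRun k a p).toFinset ≠ Finset.univ := by
  intro h
  have := card_toFinset_residueRun a (p := p) (by omega)
  rw [h, Finset.card_univ, ZMod.card] at this
  omega

theorem filter_residueRun_eq {a g : ZMod (k + 1)} {p : ℕ}
    (hg : g ∉ (residueRun k a p).toFinset) :
    (residueRun k g (k + 1)).filter (fun x => decide (x ∈ (residueRun k a p).toFinset)) =
      residueRun k a p := by
  obtain ⟨t, ht, rfl⟩ : ∃ t : ℕ, t < k + 1 ∧ a = g + t :=
    ⟨(a - g).val, ZMod.val_lt _, by rw [ZMod.natCast_zmod_val]; ring⟩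
  have htp : t + p ≤ k + 1 := by
    by_contra hlt
    refine hg (List.mem_toFinset.2 (mem_residueRun.2 ⟨k + 1 - t, by omega, ?_⟩))
    rw [Nat.cast_sub ht.le]
    push_cast
    linear_combination zmod_natCast_add_one k
  obtain ⟨w, hw⟩ := Nat.exists_eq_add_of_le htp
  have hout : ∀ u : ℕ, u < k + 1 → (u < t ∨ t + p ≤ u) →
      g + (u : ZMod (k + 1)) ∉ residueRun k (g + t) p := by
    intro u hu hut hmem
    obtain ⟨v, hv, he⟩ := mem_residueRun.1 hmem
    have he' : ((t + v : ℕ) : ZMod (k + 1)) = u := by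
      push_cast
      linear_combination he
    rcases hut with hut | hut
    · exact zmod_natCast_ne' (by omega) (by omega) he'
    · exact zmod_natCast_ne (by omega) (by omega) he'
  simp only [List.mem_toFinset]
  have hrun : residueRun k g (k + 1) = residueRun k g (t + p + w) :=
    congrArg (residueRun k g) hw
  rw [hrun, residueRun_add, residueRun_add, List.filter_append, List.filter_append,
    List.filter_eq_nil_iff.2, List.filter_eq_self.2, List.filter_eq_nil_iff.2]
  · simp
  · intro x hx
    obtain ⟨u, hu, rfl⟩ := mem_residueRun.1 hx
    have := hout (t + p + u) (by omega) (by omega)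
    rw [decide_eq_true_eq]
    rwa [Nat.cast_add, ← add_assoc] at this
  · intro x hx
    rwa [decide_eq_true_eq]
  · intro x hx
    obtain ⟨u, hu, rfl⟩ := mem_residueRun.1 hx
    rw [decide_eq_true_eq]
    exact hout u (by omega) (by omega)

theorem gate_notMem {A : Finset (ZMod (k + 1))} (hA : A ≠ Finset.univ) : gate k A ∉ A := by
  have h : ∃ g, g ∉ A := by
    by_contra! h
    exact hA (Finset.eq_univ_of_forall h)
  rw [gate, dif_pos h]
  exact h.choose_spec

theorem uElt_toFinset_residueRun (a : ZMod (k + 1)) {p : ℕ} (hp : p ≤ k) :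
    uElt k (residueRun k a p).toFinset = upRun k a p := by
  have h := filter_residueRun_eq (gate_notMem (toFinset_residueRun_ne_univ a hp))
  rw [uElt, upRun]
  exact congrArg (fun l => (l.map (sAff k)).prod) h

theorem dElt_toFinset_residueRun (a : ZMod (k + 1)) {p : ℕ} (hp : p ≤ k) :
    dElt k (residueRun k a p).toFinset = downRun k a p := by
  have h := filter_residueRun_eq (gate_notMem (toFinset_residueRun_ne_univ a hp))
  rw [dElt, downRun, List.map_reverse, List.filter_reverse]
  exact congrArg (fun l => (l.reverse.map (sAff k)).prod) h

theorem exists_eq_toFinset_residueRun {A : Finset (ZMod (k + 1))}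
    (hAint : ∃ i j, A = cycInt k i j) (hA : A ≠ Finset.univ) :
    ∃ (a : ZMod (k + 1)) (p : ℕ), 1 ≤ p ∧ p ≤ k ∧ A = (residueRun k a p).toFinset := by
  obtain ⟨i, j, rfl⟩ := hAint
  rw [cycInt_eq_toFinset] at hA ⊢
  refine ⟨i, (j - i).val + 1, by omega, ?_, rfl⟩
  by_contra hlt
  have hv := ZMod.val_lt (j - i)
  refine hA (Finset.eq_univ_of_card _ ?_)
  rw [card_toFinset_residueRun i (by omega), ZMod.card]
  omega

end Intervals

/-- a reduced product `u_B d_A` of connected cyclic elements can be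
rewritten as `d_{A'} u_{B'}` with connected `A', B'` of the stated sizes. -/
theorem up_down_to_down_up (k : ℕ) (hk : 1 ≤ k) (A B : Finset (ZMod (k + 1)))
    (hAint : ∃ i j, A = cycInt k i j) (hBint : ∃ i j, B = cycInt k i j)
    (hA : A ≠ Finset.univ) (hB : B ≠ Finset.univ)
    (hAne : A.Nonempty) (hBne : B.Nonempty)
    (hred : affLen k (uElt k B * dElt k A) = A.card + B.card) :
    ∃ A' B' : Finset (ZMod (k + 1)),
      (∃ i j, A' = cycInt k i j) ∧ (∃ i j, B' = cycInt k i j) ∧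
      A' ≠ Finset.univ ∧ B' ≠ Finset.univ ∧ A'.Nonempty ∧ B'.Nonempty ∧
      A'.card + B'.card = A.card + B.card ∧
      uElt k B * dElt k A = dElt k A' * uElt k B' ∧
      ((A'.card = A.card ∧ B'.card = B.card) ∨
        (A'.card = A.card + 1 ∧ B'.card + 1 = B.card) ∨
        (A'.card + 1 = A.card ∧ B'.card = B.card + 1)) := by
  obtain ⟨a, p, hp, hp', rfl⟩ := exists_eq_toFinset_residueRun hAint hA
  obtain ⟨b, q, hq, hq', rfl⟩ := exists_eq_toFinset_residueRun hBint hB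
  rw [card_toFinset_residueRun a (by omega), card_toFinset_residueRun b (by omega)] at *
  rw [uElt_toFinset_residueRun b hq', dElt_toFinset_residueRun a hp'] at *
  have hne : a + p ≠ b + q := fun h =>
    (affLen_upRun_mul_downRun_lt hk hp hq h).ne hred
  obtain ⟨a', b', r, s, hr, hr', hs, hs', he, hsize⟩ := hasDownUp_of_top_ne hp hq hp' hq' hne
  have hnonempty : ∀ (c : ZMod (k + 1)) {m : ℕ}, 1 ≤ m → (residueRun k c m).toFinset.Nonempty :=
    fun c m hm => ⟨c, List.mem_toFinset.2 (mem_residueRun.2 ⟨0, hm, by simp⟩)⟩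
  refine ⟨(residueRun k a' r).toFinset, (residueRun k b' s).toFinset,
    ⟨_, _, toFinset_residueRun_eq_cycInt a' hr (by omega)⟩,
    ⟨_, _, toFinset_residueRun_eq_cycInt b' hs (by omega)⟩,
    toFinset_residueRun_ne_univ a' hr', toFinset_residueRun_ne_univ b' hs',
    hnonempty a' hr, hnonempty b' hs, ?_⟩
  rw [card_toFinset_residueRun a' (by omega), card_toFinset_residueRun b' (by omega),
    uElt_toFinset_residueRun b' hs', dElt_toFinset_residueRun a' hr']
  exact ⟨by omega, he, hsize⟩
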